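/- arXiv:math/0301089 — 2 statements merged into one kernel-verified Lean document; each statement's English description precedes it below -/
import Mathlib

section
/- The level-1 weight-2 Eisenstein series G₂*(z) = 2ζ(2) + 2Σ_{m≥1}Σ_{n∈ℤ}(mz+n)^{-2} satisfies the transformation law G₂*|₂α (z) = G₂*(z) - 2πi c/(cz+d) for all α = [[a,b],[c,d]] ∈ SL(2,ℤ). -/
open Complex

/-- The level-1 weight-2 Eisenstein series
`G₂*(z) = 2ζ(2) + 2 Σ_{m≥1} Σ_{n∈ℤ} (mz+n)⁻²`. -/
noncomputable def G2star (z : ℂ) : ℂ :=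
  2 * riemannZeta 2 + 2 * ∑' m : ℕ, ∑' n : ℤ, (((m : ℂ) + 1) * z + (n : ℂ)) ^ (-2 : ℤ)

lemma tsum_int_add_zpow_neg_two (m : ℕ) (z : UpperHalfPlane) :
    ∑' n : ℤ, (((m : ℂ) + 1) * z + (n : ℂ)) ^ (-2 : ℤ) =
      (-4 * Real.pi ^ 2) * ∑' c : ℕ+, (c : ℂ) ^ 1 *
        cexp (2 * Real.pi * I * z) ^ ((m + 1) * (c : ℕ)) := by
  have h := EisensteinSeries.qExpansion_identity_pnat (k := 1) le_rfl
    ⟨((m : ℂ) + 1) * z, by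
      simpa [show 0 < (m : ℝ) + 1 by positivity] using z.im_pos⟩
  have hpi : (-2 * (Real.pi : ℂ) * I) ^ (1 + 1) / (Nat.factorial 1 : ℂ) = -4 * Real.pi ^ 2 := by
    norm_num [mul_pow]
  rw [hpi] at h
  simp only [zpow_neg, zpow_ofNat, ← one_div]
  refine h.trans ?_
  congr 1
  refine tsum_congr fun c ↦ ?_
  rw [pow_mul, ← Complex.exp_nat_mul _ (m + 1)]
  push_cast
  ring_nf

lemma G2star_eq_G2 (z : UpperHalfPlane) : G2star z = EisensteinSeries.G2 z := by
  have h := tsum_prod_pow_eq_tsum_sigma 1 (UpperHalfPlane.norm_exp_two_pi_I_lt_one z)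
  rw [tsum_pnat_eq_tsum_succ (f := fun d ↦ ∑' c : ℕ+, (c : ℂ) ^ 1 *
    cexp (2 * Real.pi * I * z) ^ (d * c : ℕ))] at h
  simp_rw [G2star, tsum_int_add_zpow_neg_two]
  rw [tsum_mul_left, h, EisensteinSeries.G2_eq_tsum_cexp]
  ring

/-- `G₂*` satisfies the transformation law
`(G₂*|₂α)(z) = G₂*(z) - 2πi c/(cz+d)` for every `α ∈ SL(2,ℤ)`. -/
theorem G2star_transformation (A : Matrix.SpecialLinearGroup (Fin 2) ℤ)
    (z : ℂ) (hz : 0 < z.im) :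
    (((A : Matrix (Fin 2) (Fin 2) ℤ) 1 0 : ℂ) * z
        + ((A : Matrix (Fin 2) (Fin 2) ℤ) 1 1 : ℂ)) ^ (-2 : ℤ) *
      G2star ((((A : Matrix (Fin 2) (Fin 2) ℤ) 0 0 : ℂ) * z
          + ((A : Matrix (Fin 2) (Fin 2) ℤ) 0 1 : ℂ)) /
        (((A : Matrix (Fin 2) (Fin 2) ℤ) 1 0 : ℂ) * z
          + ((A : Matrix (Fin 2) (Fin 2) ℤ) 1 1 : ℂ)))
      = G2star z - 2 * (Real.pi : ℂ) * Complex.I *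
          ((A : Matrix (Fin 2) (Fin 2) ℤ) 1 0 : ℂ) /
          (((A : Matrix (Fin 2) (Fin 2) ℤ) 1 0 : ℂ) * z
            + ((A : Matrix (Fin 2) (Fin 2) ℤ) 1 1 : ℂ)) := by
  have h := congrFun (EisensteinSeries.G2_slash_action A) ⟨z, hz⟩
  rw [ModularForm.SL_slash_apply, Pi.sub_apply, ← G2star_eq_G2, ← G2star_eq_G2,
    EisensteinSeries.D2, UpperHalfPlane.coe_specialLinearGroup_apply,
    ModularGroup.denom_apply, mul_comm] at h
  simpa using h
end

section
/- Every modular form g of weight 2 for some congruence subgroup that solves the Riccati equation (1/2πi) g' + (1/2)g² = (1/2πi)(g₂*)' - (1/2)(g₂*)², where g₂* = (1/2πi) d/dz log η⁴, must be equal to g₂* plus a function of the form 1/(πiz + c); since such a function is never 1-periodic unless identically zero and g₂* is not modular, there is no modular form solution. -/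
open Complex

/-- `GL⁺(2,ℚ)`. -/
abbrev GQ := Matrix.GLPos (Fin 2) ℚ

/-- The underlying rational matrix of an element of `GL⁺(2,ℚ)`. -/
def matOf (g : GQ) : Matrix (Fin 2) (Fin 2) ℚ :=
  ((g : Matrix.GeneralLinearGroup (Fin 2) ℚ) : Matrix (Fin 2) (Fin 2) ℚ)

/-- The Möbius action `γ·z = (az+b)/(cz+d)` of `GL⁺(2,ℚ)` on the upper half-plane. -/
noncomputable def moeb (g : GQ) (z : ℂ) : ℂ :=
  ((matOf g 0 0 : ℚ) * z + (matOf g 0 1 : ℚ)) /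
    ((matOf g 1 0 : ℚ) * z + (matOf g 1 1 : ℚ))

/-- The automorphy factor `j(γ,z) = cz+d`. -/
noncomputable def jfac (g : GQ) (z : ℂ) : ℂ :=
  (matOf g 1 0 : ℚ) * z + (matOf g 1 1 : ℚ)

/-- The weight-`k` slash action `(f|ₖγ)(z) = det(γ)^{k/2} f(γ·z) (cz+d)^{-k}`. -/
noncomputable def slashf (k : ℤ) (g : GQ) (f : ℂ → ℂ) : ℂ → ℂ :=
  fun z => (((matOf g).det : ℂ)) ^ ((k : ℂ) / 2) * f (moeb g z) * jfac g z ^ (-k)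

/-- The Dedekind eta function. -/
noncomputable def dedekindEta (z : ℂ) : ℂ :=
  Complex.exp ((Real.pi : ℂ) * Complex.I * z / 12) *
    ∏' n : ℕ, (1 - Complex.exp (2 * (Real.pi : ℂ) * Complex.I * ((n : ℂ) + 1) * z))

/-- The cocycle `μ_γ = (1/2πi) d/dz log(η⁴∘γ / η⁴)`. -/
noncomputable def muC (g : GQ) : ℂ → ℂ :=
  fun z => (1 / (2 * (Real.pi : ℂ) * Complex.I)) *
    logDeriv (fun w => dedekindEta (moeb g w) ^ 4 / dedekindEta w ^ 4) z

/-- `g₂* = (1/2πi) d/dz log η⁴`. -/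
noncomputable def g2star : ℂ → ℂ :=
  fun z => (1 / (2 * (Real.pi : ℂ) * Complex.I)) * logDeriv (fun w => dedekindEta w ^ 4) z

/-- The Ramanujan operator `X = (1/2πi) d/dz - g₂*·Y` on forms of weight `k`
(where `Y` acts as `k/2`). -/
noncomputable def Xw (k : ℤ) (f : ℂ → ℂ) : ℂ → ℂ :=
  fun z => (1 / (2 * (Real.pi : ℂ) * Complex.I)) * deriv f z
    - ((k : ℂ) / 2) * g2star z * f z

/-- `ω₄ = X(g₂*) + (1/2)(g₂*)²`. -/
noncomputable def omega4 : ℂ → ℂ :=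
  fun z => Xw 2 g2star z + (1 / 2) * g2star z ^ 2

open UpperHalfPlane in
/-- The upper half-plane is preconnected. -/
lemma isPreconnected_upperHalfPlaneSet : IsPreconnected upperHalfPlaneSet :=
  (convex_halfSpace_im_gt 0).isPreconnected

/-- Holomorphic solutions of `h' = -a h²` on an open preconnected set either vanish identically
or are everywhere equal to `1 / (az + c)` for some constant `c`. -/
lemma eq_zero_or_eq_one_div_of_deriv_eq_neg_mul_sq {U : Set ℂ} (hU : IsOpen U)
    (hU' : IsPreconnected U) {a : ℂ} {h : ℂ → ℂ} (hd : DifferentiableOn ℂ h U)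
    (hode : ∀ z ∈ U, deriv h z = -a * h z ^ 2) :
    (∀ z ∈ U, h z = 0) ∨ ∃ c : ℂ, ∀ z ∈ U, h z = 1 / (a * z + c) := by
  by_contra! hcon
  obtain ⟨⟨z₀, hz₀, hne⟩, hcon⟩ := hcon
  obtain ⟨z, hz, hz'⟩ := hcon ((h z₀)⁻¹ - a * z₀)
  refine hz' (eq_one_div_of_mul_eq_one_left ?_)
  have han : AnalyticOnNhd ℂ (fun w ↦ h w * (a * w + ((h z₀)⁻¹ - a * z₀))) U :=
    (hd.mul (by fun_prop)).analyticOnNhd hU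
  refine han.eqOn_of_preconnected_of_eventuallyEq (g := fun _ ↦ 1) analyticOnNhd_const
    hU' hz₀ ?_ hz
  have hnhds : ∀ᶠ w in nhds z₀, w ∈ U ∧ h w ≠ 0 :=
    Filter.Eventually.and (hU.mem_nhds hz₀)
      ((hd.continuousOn.continuousAt (hU.mem_nhds hz₀)).eventually_ne hne)
  obtain ⟨r, hr, hball⟩ := Metric.eventually_nhds_iff_ball.mp hnhds
  have hderiv : ∀ w ∈ Metric.ball z₀ r, HasDerivAt (fun w ↦ (h w)⁻¹ - a * w) 0 w := by
    intro w hw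
    obtain ⟨hwU, hw0⟩ := hball w hw
    have h1 := (hd.differentiableAt (hU.mem_nhds hwU)).hasDerivAt
    rw [hode w hwU] at h1
    convert! (h1.inv hw0).sub ((hasDerivAt_id w).const_mul a) using 1
    field_simp
    ring
  filter_upwards [Metric.ball_mem_nhds z₀ hr] with w hw
  have hconst := Metric.isOpen_ball.is_const_of_deriv_eq_zero
    (convex_ball z₀ r).isPreconnected
    (fun w hw ↦ (hderiv w hw).differentiableAt.differentiableWithinAt)
    (fun w hw ↦ (hderiv w hw).deriv) hw (Metric.mem_ball_self hr)
  have hw0 := (hball w hw).2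
  beta_reduce at hconst ⊢
  rw [← hconst]
  field_simp
  ring

open ModularForm in
lemma dedekindEta_eq_eta : dedekindEta = ModularForm.eta := by
  funext z
  have h : (Real.pi : ℂ) * Complex.I * z / 12 = 2 * Real.pi * Complex.I * z / (24 : ℝ) := by
    push_cast
    ring
  simp only [dedekindEta, ModularForm.eta, eta_q_eq_cexp, Function.Periodic.qParam, h]

open ModularForm in
lemma g2star_eqOn_logDeriv_eta : Set.EqOn g2star
    (fun z ↦ 4 / (2 * (Real.pi : ℂ) * Complex.I) * logDeriv ModularForm.eta z)
    UpperHalfPlane.upperHalfPlaneSet := by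
  intro z hz
  simp only [g2star, dedekindEta_eq_eta]
  rw [logDeriv_fun_pow (differentiableAt_eta_of_mem_upperHalfPlaneSet hz)]
  push_cast
  ring

open ModularForm UpperHalfPlane in
lemma differentiableOn_g2star : DifferentiableOn ℂ g2star upperHalfPlaneSet := by
  have hη : DifferentiableOn ℂ ModularForm.eta upperHalfPlaneSet := fun z hz ↦
    (differentiableAt_eta_of_mem_upperHalfPlaneSet hz).differentiableWithinAt
  have hlog : DifferentiableOn ℂ (logDeriv ModularForm.eta) upperHalfPlaneSet :=
    (hη.deriv isOpen_upperHalfPlaneSet).div hη (fun _ hz ↦ eta_ne_zero hz)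
  exact (hlog.const_mul _).congr g2star_eqOn_logDeriv_eta

open UpperHalfPlane EisensteinSeries in
lemma g2star_coe (τ : ℍ) : g2star τ = E2 τ / 6 := by
  simp only [g2star_eqOn_logDeriv_eta τ.2, ModularForm.logDeriv_eta_eq_E2]
  field_simp
  ring

open UpperHalfPlane EisensteinSeries in
/-- The quasi-modular transformation law of `g₂*`. -/
lemma g2star_smul (γ : Matrix.SpecialLinearGroup (Fin 2) ℤ) (τ : ℍ) :
    g2star (γ • τ : ℍ) =
      denom γ τ ^ (2 : ℤ) * (g2star τ - 1 / (12 * riemannZeta 2) * D2 γ τ) := by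
  have h := congrFun (E2_slash_action γ) τ
  rw [ModularForm.SL_slash_apply, zpow_neg, ← div_eq_mul_inv,
    div_eq_iff (zpow_ne_zero 2 (denom_ne_zero γ τ))] at h
  rw [g2star_coe, g2star_coe, h]
  simp only [Pi.sub_apply, Pi.smul_apply, smul_eq_mul]
  ring

open UpperHalfPlane in
lemma riccati_solution_eq {g : ℂ → ℂ} (hg : DifferentiableOn ℂ g upperHalfPlaneSet)
    (hode : ∀ z ∈ upperHalfPlaneSet,
      (1 / (2 * (Real.pi : ℂ) * Complex.I)) * deriv g z - g2star z * g z + (1 / 2) * g z ^ 2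
        = (1 / (2 * (Real.pi : ℂ) * Complex.I)) * deriv g2star z - (1 / 2) * g2star z ^ 2) :
    (∀ z ∈ upperHalfPlaneSet, g z = g2star z) ∨
      ∃ c : ℂ, ∀ z ∈ upperHalfPlaneSet, g z = g2star z + 1 / ((Real.pi : ℂ) * Complex.I * z + c) := by
  have h := eq_zero_or_eq_one_div_of_deriv_eq_neg_mul_sq (a := Real.pi * Complex.I)
    isOpen_upperHalfPlaneSet isPreconnected_upperHalfPlaneSet (hg.sub differentiableOn_g2star) ?_
  · simpa only [Pi.sub_apply, sub_eq_iff_eq_add', add_zero] using h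
  · intro z hz
    have hnhds := isOpen_upperHalfPlaneSet.mem_nhds hz
    rw [deriv_sub (hg.differentiableAt hnhds) (differentiableOn_g2star.differentiableAt hnhds)]
    have h1 := hode z hz
    field_simp at h1
    simp only [Pi.sub_apply]
    linear_combination h1

open UpperHalfPlane CongruenceSubgroup in
/-- The quasi-modular form `g₂*` is not modular of weight two for any `Γ(N)`. -/
lemma modularForm_ne_g2star {N : ℕ} (hN : 0 < N) (f : ModularForm (Gamma N) 2) :
    ¬ ∀ τ : ℍ, f τ = g2star τ := by
  intro hf
  let γ : Matrix.SpecialLinearGroup (Fin 2) ℤ := ⟨!![1, 0; N, 1], by simp⟩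
  have hγ : γ ∈ CongruenceSubgroup.Gamma N := by
    rw [Gamma_mem]
    simp [γ]
  have h := SlashInvariantForm.slash_action_eqn_SL'' f hγ UpperHalfPlane.I
  rw [hf, hf, g2star_smul, mul_right_inj' (zpow_ne_zero 2 (denom_ne_zero γ UpperHalfPlane.I))] at h
  have hc : γ 1 0 = N := by simp [γ]
  have h2 : riemannZeta 2 ≠ 0 := riemannZeta_ne_zero_of_one_lt_re (by simp)
  simp [EisensteinSeries.D2, hc, h2, hN.ne'] at h
  exact denom_ne_zero γ UpperHalfPlane.I h

open UpperHalfPlane in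
lemma g2star_T_zpow_smul (n : ℤ) (τ : ℍ) :
    g2star (ModularGroup.T ^ n • τ : ℍ) = g2star τ := by
  have hd : denom (ModularGroup.T ^ n : Matrix.SpecialLinearGroup (Fin 2) ℤ) τ = 1 := by
    rw [ModularGroup.denom_apply]
    simp [ModularGroup.coe_T_zpow]
  rw [g2star_smul, hd]
  simp [EisensteinSeries.D2, ModularGroup.coe_T_zpow]

open UpperHalfPlane CongruenceSubgroup in
/-- No modular form of weight two for `Γ(N)` differs from `g₂*` by a function `1 / (πiz + c)`. -/
lemma modularForm_ne_g2star_add {N : ℕ} (hN : 0 < N) (f : ModularForm (Gamma N) 2) (c : ℂ) :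
    ¬ ∀ τ : ℍ, f τ = g2star τ + 1 / ((Real.pi : ℂ) * Complex.I * τ + c) := by
  intro hf
  have h := SlashInvariantForm.T_zpow_width_invariant N 2 1 f UpperHalfPlane.I
  change f _ = f _ at h
  rw [hf, hf, g2star_T_zpow_smul, add_right_inj, one_div, one_div, inv_inj, add_left_inj,
    mul_right_inj' (by simp), modular_T_zpow_smul] at h
  simp [hN.ne'] at h

/-- The Riccati equation `X(g) + (1/2)g² = ω₄`, i.e.
`(1/2πi)g' - g₂*·g + (1/2)g² = (1/2πi)(g₂*)' - (1/2)(g₂*)²`, has no modular-form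
solution.  Key steps: (a) any holomorphic `h` on the upper half-plane with
`(1/2πi)h' + (1/2)h² = 0` equals `0` or `1/(πiz+c)`; (b) any holomorphic
solution `g` of the Riccati equation equals `g₂*` or `g₂* + 1/(πiz+c)`;
(c) there is no weight-2 modular form (for any congruence subgroup `Γ(N)`)
solving the equation. -/
theorem riccati_no_modular_solution :
    (∀ h : ℂ → ℂ, DifferentiableOn ℂ h {z : ℂ | 0 < z.im} →
      (∀ z ∈ {z : ℂ | 0 < z.im},
          (1 / (2 * (Real.pi : ℂ) * Complex.I)) * deriv h z + (1 / 2) * h z ^ 2 = 0) →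
      (∀ z ∈ {z : ℂ | 0 < z.im}, h z = 0) ∨
        ∃ c : ℂ, ∀ z ∈ {z : ℂ | 0 < z.im},
          h z = 1 / ((Real.pi : ℂ) * Complex.I * z + c)) ∧
    (∀ g : ℂ → ℂ, DifferentiableOn ℂ g {z : ℂ | 0 < z.im} →
      (∀ z ∈ {z : ℂ | 0 < z.im},
          (1 / (2 * (Real.pi : ℂ) * Complex.I)) * deriv g z - g2star z * g z
              + (1 / 2) * g z ^ 2
            = (1 / (2 * (Real.pi : ℂ) * Complex.I)) * deriv g2star z
              - (1 / 2) * g2star z ^ 2) →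
      (∀ z ∈ {z : ℂ | 0 < z.im}, g z = g2star z) ∨
        ∃ c : ℂ, ∀ z ∈ {z : ℂ | 0 < z.im},
          g z = g2star z + 1 / ((Real.pi : ℂ) * Complex.I * z + c)) ∧
    ¬ ∃ (N : ℕ) (_ : 0 < N)
        (f : ModularForm (CongruenceSubgroup.Gamma N) 2) (G : ℂ → ℂ),
          DifferentiableOn ℂ G {z : ℂ | 0 < z.im} ∧
          (∀ τ : UpperHalfPlane, G (τ : ℂ) = f τ) ∧
          (∀ z ∈ {z : ℂ | 0 < z.im},
            (1 / (2 * (Real.pi : ℂ) * Complex.I)) * deriv G z - g2star z * G z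
                + (1 / 2) * G z ^ 2
              = (1 / (2 * (Real.pi : ℂ) * Complex.I)) * deriv g2star z
                - (1 / 2) * g2star z ^ 2) := by
  refine ⟨fun h hd hode ↦ ?_, fun g hg hode ↦ riccati_solution_eq hg hode, ?_⟩
  · refine eq_zero_or_eq_one_div_of_deriv_eq_neg_mul_sq
      UpperHalfPlane.isOpen_upperHalfPlaneSet isPreconnected_upperHalfPlaneSet hd fun z hz ↦ ?_
    have h1 := hode z hz
    field_simp at h1
    linear_combination h1
  · rintro ⟨N, hN, f, G, hG, hGf, hode⟩
    rcases riccati_solution_eq hG hode with h | ⟨c, h⟩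
    · exact modularForm_ne_g2star hN f fun τ ↦ by rw [← hGf, h τ τ.2]
    · exact modularForm_ne_g2star_add hN f c fun τ ↦ by rw [← hGf, h τ τ.2]
end
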